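/- Let x, x' ∈ S^N be states and i an index such that x'_j = x_j for all j ≠ i, h_i(x) ∈ D, and x'_i = csgn(h_i(x)) ≠ x_i. Then E(x') < E(x). That is, the energy of the complex-valued multistate recurrent correlation neural network strictly decreases whenever a single (asynchronously updated) neuron changes its state; consequently the asynchronous dynamics also always settles at an equilibrium. -/

import Mathlib

open scoped Classical

/-- The argument of a complex number taken in `[0, 2π)`. -/
noncomputable def arg2pi (z : ℂ) : ℝ :=
  if Complex.arg z < 0 then Complex.arg z + 2 * Real.pi else Complex.arg z

/-- The domain `D` of the complex-valued multistate signum function: nonzero complex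
numbers whose argument (in `[0, 2π)`) differs from `(2k-1)·Δθ` for all `k = 1,…,K`,
where `Δθ = π/K`. -/
def Dset (K : ℕ) : Set ℂ :=
  {z | z ≠ 0 ∧ ∀ k : ℕ, 1 ≤ k → k ≤ K → arg2pi z ≠ (2 * (k : ℝ) - 1) * (Real.pi / K)}

/-- The set `S = {e^{2kΔθ·i} : k = 0,…,K-1}` of `K`-th roots of unity, `Δθ = π/K`. -/
def Sset (K : ℕ) : Set ℂ :=
  {s | ∃ k : ℕ, k < K ∧ s = Complex.exp ((2 * (k : ℝ) * (Real.pi / K) : ℝ) * Complex.I)}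

/-- `csgn` is a complex-valued multistate signum function with resolution factor `K`:
for every `z ∈ D`, `csgn z` is the element `s ∈ S` such that the argument of
`z · conj s` lies in the open interval `(-Δθ, Δθ)` modulo `2π`. -/
def IsCsgn (K : ℕ) (csgn : ℂ → ℂ) : Prop :=
  ∀ z ∈ Dset K, csgn z ∈ Sset K ∧
    Complex.arg (z * (starRingEnd ℂ) (csgn z)) ∈ Set.Ioo (-(Real.pi / K)) (Real.pi / K)

/-- Correlation `Σ_i Re(conj(u_i^ξ)·x_i)` of a state with the `ξ`-th fundamental memory. -/
noncomputable def cOverlap {N P : ℕ} (u : Fin P → Fin N → ℂ) (x : Fin N → ℂ) (ξ : Fin P) : ℝ :=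
  ∑ i, ((starRingEnd ℂ) (u ξ i) * x i).re

/-- Activation potential `h_i(x) = Σ_ξ w_ξ(x)·u_i^ξ` with `w_ξ(x) = f(cOverlap u x ξ)`. -/
noncomputable def cPot {N P : ℕ} (f : ℝ → ℝ) (u : Fin P → Fin N → ℂ) (x : Fin N → ℂ)
    (i : Fin N) : ℂ :=
  ∑ ξ, (f (cOverlap u x ξ) : ℂ) * u ξ i

/-- Energy of the complex-valued recurrent correlation neural network. -/
noncomputable def cEnergy {N P : ℕ} (F : ℝ → ℝ) (u : Fin P → Fin N → ℂ) (x : Fin N → ℂ) : ℝ :=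
  -∑ ξ, F (cOverlap u x ξ)

lemma aux_cos (K : ℕ) (hK : 1 < K) (φ : ℝ) (h1 : -(Real.pi / K) < φ) (h2 : φ < Real.pi / K)
    (k l : ℕ) (hk : k < K) (hl : l < K) (hne : k ≠ l) :
    Real.cos (φ + (2 * (k : ℝ) * (Real.pi / K) - 2 * (l : ℝ) * (Real.pi / K))) < Real.cos φ := by
  have hK0 : (0 : ℝ) < K := by positivity
  obtain ⟨d, hd⟩ : ∃ d, d = Real.pi / K := ⟨_, rfl⟩
  have hdpos : 0 < d := by rw [hd]; positivity
  have hpi : Real.pi = K * d := by rw [hd]; field_simp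
  rw [← hd] at h1 h2 ⊢
  rw [← sub_neg, Real.cos_sub_cos]
  have e1 : (φ + (2 * (k : ℝ) * d - 2 * (l : ℝ) * d) + φ) / 2 = φ + ((k : ℝ) - l) * d := by ring
  have e2 : (φ + (2 * (k : ℝ) * d - 2 * (l : ℝ) * d) - φ) / 2 = ((k : ℝ) - l) * d := by ring
  rw [e1, e2]
  have hkK : (k : ℝ) + 1 ≤ K := by exact_mod_cast hk
  have hlK : (l : ℝ) + 1 ≤ K := by exact_mod_cast hl
  have hk0 : (0 : ℝ) ≤ k := by positivity
  have hl0 : (0 : ℝ) ≤ l := by positivity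
  rcases lt_or_gt_of_ne hne with h | h
  · have h' : (k : ℝ) + 1 ≤ l := by exact_mod_cast h
    have s1 : Real.sin (φ + ((k : ℝ) - l) * d) < 0 :=
      Real.sin_neg_of_neg_of_neg_pi_lt (by nlinarith) (by rw [hpi]; nlinarith)
    have s2 : Real.sin (((k : ℝ) - l) * d) < 0 :=
      Real.sin_neg_of_neg_of_neg_pi_lt (by nlinarith) (by rw [hpi]; nlinarith)
    nlinarith [mul_pos_of_neg_of_neg s1 s2]
  · have h' : (l : ℝ) + 1 ≤ k := by exact_mod_cast h
    have s1 : 0 < Real.sin (φ + ((k : ℝ) - l) * d) :=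
      Real.sin_pos_of_pos_of_lt_pi (by nlinarith) (by rw [hpi]; nlinarith)
    have s2 : 0 < Real.sin (((k : ℝ) - l) * d) :=
      Real.sin_pos_of_pos_of_lt_pi (by nlinarith) (by rw [hpi]; nlinarith)
    nlinarith [mul_pos s1 s2]

lemma aux_re (K : ℕ) (hK : 1 < K) (h s y : ℂ) (h0 : h ≠ 0) (hs : s ∈ Sset K) (hy : y ∈ Sset K)
    (hsy : s ≠ y)
    (ha : Complex.arg (h * (starRingEnd ℂ) s) ∈ Set.Ioo (-(Real.pi / K)) (Real.pi / K)) :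
    (h * (starRingEnd ℂ) y).re < (h * (starRingEnd ℂ) s).re := by
  obtain ⟨k, hk, rfl⟩ := hs
  obtain ⟨l, hl, rfl⟩ := hy
  have hne : k ≠ l := by rintro rfl; exact hsy rfl
  have key := aux_cos K hK _ ha.1 ha.2 k l hk hl hne
  set α : ℝ := 2 * (k : ℝ) * (Real.pi / K) with hα
  set β : ℝ := 2 * (l : ℝ) * (Real.pi / K) with hβ
  set z := h * (starRingEnd ℂ) (Complex.exp ((α : ℂ) * Complex.I)) with hz
  have hz0 : z ≠ 0 := by
    rw [hz]
    exact mul_ne_zero h0 ((map_ne_zero _).2 (Complex.exp_ne_zero _))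
  have c : ∀ t : ℝ, (starRingEnd ℂ) (Complex.exp ((t : ℂ) * Complex.I))
      = Complex.exp (-((t : ℂ) * Complex.I)) := by
    intro t
    rw [← Complex.exp_conj]; simp
  have e : h * (starRingEnd ℂ) (Complex.exp ((β : ℂ) * Complex.I))
      = (‖z‖ : ℂ) * Complex.exp (((Complex.arg z + (α - β) : ℝ) : ℂ) * Complex.I) := by
    have : h * (starRingEnd ℂ) (Complex.exp ((β : ℂ) * Complex.I))
      = z * Complex.exp (((α - β : ℝ) : ℂ) * Complex.I) := by
      rw [hz, c, c, mul_assoc, ← Complex.exp_add]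
      congr 2; push_cast; ring
    rw [this]
    conv_lhs => rw [← Complex.norm_mul_exp_arg_mul_I z]
    rw [mul_assoc, ← Complex.exp_add]
    congr 2; push_cast; ring
  have e' : z.re = ‖z‖ * Real.cos (Complex.arg z) := (Complex.norm_mul_cos_arg z).symm
  rw [e, Complex.re_ofReal_mul, Complex.exp_ofReal_mul_I_re, e']
  exact mul_lt_mul_of_pos_left key (norm_pos_iff.2 hz0)

lemma aux_convex (f F : ℝ → ℝ) (hmono : Monotone f) (hF : ∀ t : ℝ, HasDerivAt F (f t) t)
    (a b : ℝ) : f a * (b - a) ≤ F b - F a := by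
  have hc : Continuous F := continuous_iff_continuousAt.2 fun t => (hF t).continuousAt
  rcases lt_trichotomy a b with h | h | h
  · obtain ⟨c, hc, he⟩ := exists_hasDerivAt_eq_slope F f h hc.continuousOn (fun t _ => hF t)
    rw [eq_div_iff (by linarith)] at he
    nlinarith [hmono hc.1.le]
  · subst h; simp
  · obtain ⟨c, hc, he⟩ := exists_hasDerivAt_eq_slope F f h hc.continuousOn (fun t _ => hF t)
    rw [eq_div_iff (by linarith)] at he
    nlinarith [hmono hc.2.le]

/-- The energy of the complex-valued multistate RCNN strictly decreases whenever a
single (asynchronously updated) neuron changes its state. -/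
theorem complex_multistate_energy_decreases_async (K : ℕ) (hK : 1 < K)
    (csgn : ℂ → ℂ) (hcsgn : IsCsgn K csgn)
    {N P : ℕ} (hN : 1 ≤ N) (hP : 1 ≤ P)
    (f F : ℝ → ℝ) (hf : Continuous f) (hmono : Monotone f)
    (hF : ∀ t : ℝ, HasDerivAt F (f t) t)
    (u : Fin P → Fin N → ℂ) (hu : ∀ ξ i, u ξ i ∈ Sset K)
    (x x' : Fin N → ℂ) (hx : ∀ j, x j ∈ Sset K) (hx' : ∀ j, x' j ∈ Sset K)
    (i : Fin N) (hsame : ∀ j, j ≠ i → x' j = x j)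
    (hpot : cPot f u x i ∈ Dset K)
    (hupd : x' i = csgn (cPot f u x i))
    (hchange : x' i ≠ x i) :
    cEnergy F u x' < cEnergy F u x := by
  obtain ⟨hsS, harg⟩ := hcsgn _ hpot
  rw [← hupd] at hsS harg
  have key := aux_re K hK _ _ _ hpot.1 hsS (hx i) hchange harg
  have hov : ∀ ξ, cOverlap u x' ξ - cOverlap u x ξ
      = ((starRingEnd ℂ) (u ξ i) * x' i).re - ((starRingEnd ℂ) (u ξ i) * x i).re := by
    intro ξ
    unfold cOverlap
    rw [← Finset.sum_sub_distrib]
    apply Finset.sum_eq_single i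
    · intro j _ hj
      rw [hsame j hj, sub_self]
    · simp
  have hsum : ∀ y : ℂ, (cPot f u x i * (starRingEnd ℂ) y).re
      = ∑ ξ, f (cOverlap u x ξ) * ((starRingEnd ℂ) (u ξ i) * y).re := by
    intro y
    unfold cPot
    rw [Finset.sum_mul, Complex.re_sum]
    refine Finset.sum_congr rfl fun ξ _ => ?_
    rw [mul_assoc, Complex.re_ofReal_mul]
    congr 1
    simp
  have hle : ∑ ξ, f (cOverlap u x ξ) * (cOverlap u x' ξ - cOverlap u x ξ)
      ≤ ∑ ξ, (F (cOverlap u x' ξ) - F (cOverlap u x ξ)) :=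
    Finset.sum_le_sum fun ξ _ => aux_convex f F hmono hF _ _
  simp only [hov, mul_sub, Finset.sum_sub_distrib] at hle
  rw [← hsum, ← hsum] at hle
  unfold cEnergy
  linarith
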